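/- Let d ≥ 1, let γ be the standard Gaussian probability measure on ℝ^d (the d-fold product of gaussianReal 0 1), let a > 0, and let w_i, w_j ∈ ℝ^d, b_i, b_j ∈ ℝ. Then ∫_{ℝ^d} (⟨w_i, x⟩ + b_i) cos(2a(⟨w_j, x⟩ + b_j)) γ(dx) = (−2a ⟨w_i, w_j⟩ sin(2a b_j) + b_i cos(2a b_j)) · exp(−2a² ‖w_j‖²). -/

import Mathlib

open MeasureTheory ProbabilityTheory

lemma integrable_cexp_gaussianReal (z : ℂ) :
    Integrable (fun x : ℝ ↦ Complex.exp (z * x)) (gaussianReal 0 1) := by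
  have hz : z.re ∈ interior (integrableExpSet id (gaussianReal 0 1)) := by simp
  simpa using integrable_pow_mul_cexp_of_re_mem_interior_integrableExpSet hz 0

lemma integrable_mul_cexp_gaussianReal (z : ℂ) :
    Integrable (fun x : ℝ ↦ (x : ℂ) * Complex.exp (z * x)) (gaussianReal 0 1) := by
  have hz : z.re ∈ interior (integrableExpSet id (gaussianReal 0 1)) := by simp
  simpa using integrable_pow_mul_cexp_of_re_mem_interior_integrableExpSet hz 1

lemma integral_cexp_gaussianReal (z : ℂ) :
    ∫ x : ℝ, Complex.exp (z * x) ∂gaussianReal 0 1 = Complex.exp (z ^ 2 / 2) := by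
  simpa [complexMGF] using complexMGF_id_gaussianReal (μ := 0) (v := 1) z

lemma integral_mul_cexp_gaussianReal (z : ℂ) :
    ∫ x : ℝ, (x : ℂ) * Complex.exp (z * x) ∂gaussianReal 0 1 = z * Complex.exp (z ^ 2 / 2) := by
  have hz : z.re ∈ interior (integrableExpSet id (gaussianReal 0 1)) := by simp
  have hMGF : complexMGF id (gaussianReal 0 1) = fun z ↦ Complex.exp (z ^ 2 / 2) := by
    ext z
    simpa using complexMGF_id_gaussianReal (μ := 0) (v := 1) z
  have h := hasDerivAt_complexMGF hz
  rw [hMGF] at h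
  have h' : HasDerivAt (fun z : ℂ ↦ Complex.exp (z ^ 2 / 2)) (z * Complex.exp (z ^ 2 / 2)) z := by
    convert! (((hasDerivAt_id z).pow 2).div_const 2).cexp using 1
    simp
    ring
  exact h.unique h'

section Pi

variable {ι : Type*} [Fintype ι]

lemma mul_cexp_sum_mul_eq_prod [DecidableEq ι] (z : ι → ℂ) (x : ι → ℝ) (k : ι) :
    (x k : ℂ) * Complex.exp (∑ l, z l * x l) =
      ∏ l, (if l = k then (x l : ℂ) else 1) * Complex.exp (z l * x l) := by
  rw [Finset.prod_mul_distrib, Complex.exp_sum]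
  simp

lemma integrable_cexp_pi_gaussianReal (z : ι → ℂ) :
    Integrable (fun x : ι → ℝ ↦ Complex.exp (∑ l, z l * x l))
      (Measure.pi fun _ ↦ gaussianReal 0 1) := by
  simp_rw [Complex.exp_sum]
  exact Integrable.fintype_prod (f := fun l (y : ℝ) ↦ Complex.exp (z l * y))
    fun l ↦ integrable_cexp_gaussianReal (z l)

lemma integral_cexp_pi_gaussianReal (z : ι → ℂ) :
    ∫ x : ι → ℝ, Complex.exp (∑ l, z l * x l) ∂(Measure.pi fun _ ↦ gaussianReal 0 1) =
      Complex.exp (∑ l, z l ^ 2 / 2) := by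
  simp_rw [Complex.exp_sum]
  rw [integral_fintype_prod_eq_prod fun l (y : ℝ) ↦ Complex.exp (z l * y)]
  simp_rw [integral_cexp_gaussianReal]

lemma integrable_mul_cexp_pi_gaussianReal (z : ι → ℂ) (k : ι) :
    Integrable (fun x : ι → ℝ ↦ (x k : ℂ) * Complex.exp (∑ l, z l * x l))
      (Measure.pi fun _ ↦ gaussianReal 0 1) := by
  classical
  simp_rw [mul_cexp_sum_mul_eq_prod]
  refine Integrable.fintype_prod
    (f := fun l (y : ℝ) ↦ (if l = k then (y : ℂ) else 1) * Complex.exp (z l * y)) fun l ↦ ?_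
  split_ifs
  · exact integrable_mul_cexp_gaussianReal (z l)
  · simpa using integrable_cexp_gaussianReal (z l)

lemma integral_mul_cexp_pi_gaussianReal (z : ι → ℂ) (k : ι) :
    ∫ x : ι → ℝ, (x k : ℂ) * Complex.exp (∑ l, z l * x l)
        ∂(Measure.pi fun _ ↦ gaussianReal 0 1) =
      z k * Complex.exp (∑ l, z l ^ 2 / 2) := by
  classical
  simp_rw [mul_cexp_sum_mul_eq_prod]
  rw [integral_fintype_prod_eq_prod
    fun l (y : ℝ) ↦ (if l = k then (y : ℂ) else 1) * Complex.exp (z l * y)]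
  have h (l : ι) : ∫ y : ℝ, (if l = k then (y : ℂ) else 1) * Complex.exp (z l * y)
      ∂gaussianReal 0 1 = (if l = k then z l else 1) * Complex.exp (z l ^ 2 / 2) := by
    split_ifs
    · exact integral_mul_cexp_gaussianReal (z l)
    · simpa using integral_cexp_gaussianReal (z l)
  simp_rw [h, Finset.prod_mul_distrib, Complex.exp_sum]
  simp

lemma integrable_affine_mul_cexp_pi_gaussianReal (w z : ι → ℂ) (b : ℂ) :
    Integrable (fun x : ι → ℝ ↦ (∑ l, w l * x l + b) * Complex.exp (∑ l, z l * x l))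
      (Measure.pi fun _ ↦ gaussianReal 0 1) := by
  simp_rw [add_mul, Finset.sum_mul, mul_assoc]
  exact (integrable_finsetSum _ fun k _ ↦
    (integrable_mul_cexp_pi_gaussianReal z k).const_mul (w k)).add
    ((integrable_cexp_pi_gaussianReal z).const_mul b)

lemma integral_affine_mul_cexp_pi_gaussianReal (w z : ι → ℂ) (b : ℂ) :
    ∫ x : ι → ℝ, (∑ l, w l * x l + b) * Complex.exp (∑ l, z l * x l)
        ∂(Measure.pi fun _ ↦ gaussianReal 0 1) =
      (∑ l, w l * z l + b) * Complex.exp (∑ l, z l ^ 2 / 2) := by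
  simp_rw [add_mul, Finset.sum_mul, mul_assoc]
  have hint (k : ι) := (integrable_mul_cexp_pi_gaussianReal z k).const_mul (w k)
  rw [integral_add (integrable_finsetSum _ fun k _ ↦ hint k)
    ((integrable_cexp_pi_gaussianReal z).const_mul b),
    integral_finsetSum _ fun k _ ↦ hint k]
  simp_rw [integral_const_mul, integral_mul_cexp_pi_gaussianReal, integral_cexp_pi_gaussianReal]

end Pi

/-- the cross term in the snake kernel under the standard Gaussian measure:
`∫ (⟨wᵢ,x⟩+bᵢ) cos(2a(⟨w_j,x⟩+b_j)) dγ
  = (−2a ⟨wᵢ,w_j⟩ sin(2a b_j) + bᵢ cos(2a b_j)) e^{−2a²‖w_j‖²}`. -/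
theorem snake_cross_term_standard_gaussian
    (d : ℕ) (hd : 1 ≤ d) (a : ℝ) (ha : 0 < a) (wi wj : Fin d → ℝ) (bi bj : ℝ) :
    ∫ x : Fin d → ℝ,
        (∑ l : Fin d, wi l * x l + bi) * Real.cos (2 * a * (∑ l : Fin d, wj l * x l + bj))
        ∂(Measure.pi fun _ : Fin d => gaussianReal 0 1) =
      (-(2 * a) * (∑ l : Fin d, wi l * wj l) * Real.sin (2 * a * bj) +
        bi * Real.cos (2 * a * bj)) *
      Real.exp (-(2 * a ^ 2) * ∑ l : Fin d, (wj l) ^ 2) := by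
  set z : Fin d → ℂ := fun l ↦ ((2 * a * wj l : ℝ) : ℂ) * Complex.I with hz
  set c : ℂ := Complex.exp (((2 * a * bj : ℝ) : ℂ) * Complex.I) with hc
  have hre (x : Fin d → ℝ) :
      (∑ l, wi l * x l + bi) * Real.cos (2 * a * (∑ l, wj l * x l + bj)) =
        RCLike.re (c * ((∑ l, (wi l : ℂ) * x l + bi) * Complex.exp (∑ l, z l * x l))) := by
    have hphase : c * Complex.exp (∑ l, z l * x l) =
        Complex.exp ((2 * a * (∑ l, wj l * x l + bj) : ℝ) * Complex.I) := by
      rw [hc, ← Complex.exp_add]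
      congr 1
      push_cast [hz, mul_add, add_mul, Finset.mul_sum, Finset.sum_mul]
      rw [add_comm]
      congr 1
      exact Finset.sum_congr rfl fun l _ ↦ by ring
    rw [mul_left_comm, hphase, ← Complex.exp_ofReal_mul_I_re, ← Complex.re_ofReal_mul]
    push_cast
    rfl
  have hsq : ∑ l, z l ^ 2 / 2 = ((-(2 * a ^ 2) * ∑ l, wj l ^ 2 : ℝ) : ℂ) := by
    push_cast [hz, Finset.mul_sum]
    refine Finset.sum_congr rfl fun l _ ↦ ?_
    rw [mul_pow, Complex.I_sq]
    ring
  have hlin : ∑ l, (wi l : ℂ) * z l = ((2 * a * ∑ l, wi l * wj l : ℝ) : ℂ) * Complex.I := by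
    push_cast [hz, Finset.mul_sum, Finset.sum_mul]
    exact Finset.sum_congr rfl fun l _ ↦ by ring
  simp_rw [hre]
  rw [integral_re ((integrable_affine_mul_cexp_pi_gaussianReal _ z _).const_mul c),
    integral_const_mul, integral_affine_mul_cexp_pi_gaussianReal, hsq, hlin, hc,
    ← Complex.ofReal_exp, ← mul_assoc, RCLike.re_eq_complex_re, Complex.re_mul_ofReal,
    Complex.mul_re, Complex.exp_ofReal_mul_I_re, Complex.exp_ofReal_mul_I_im]
  simp only [Complex.add_re, Complex.add_im, Complex.re_ofReal_mul, Complex.im_ofReal_mul,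
    Complex.I_re, Complex.I_im, Complex.ofReal_re, Complex.ofReal_im]
  ring
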